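/- For any alphabets X and Y, the triple sum over all integer partitions satisfies Σ_{λ,μ,γ} z^{|μ|} s_{μ/γ}(X) s_{λ/γ}(Y) = Φ(Y) · ∏_{k≥1} Φ(z^k(X+Y))/(1−z^k), as an identity of formal power series, where X+Y is the disjoint union of the alphabets and z^k X denotes the alphabet X with every variable multiplied by z^k. -/

import Mathlib

open scoped BigOperators

/-- An integer partition: a weakly decreasing, finitely supported sequence of
nonnegative integers. -/
structure Ptn where
  toFun : ℕ →₀ ℕ
  antitone' : ∀ ⦃i j : ℕ⦄, i ≤ j → toFun j ≤ toFun i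

namespace Ptn
/-- the `i`-th part (0-indexed) -/
def part (lam : Ptn) (i : ℕ) : ℕ := lam.toFun i
/-- the size `|λ|` -/
def size (lam : Ptn) : ℕ := lam.toFun.sum fun _ k => k
end Ptn

/-- `HStrip μ λ` means `μ ≺ λ`, i.e. `λ/μ` is a horizontal strip:
`λ_i ≥ μ_i ≥ λ_{i+1}` for all `i`. -/
def HStrip (mu lam : Ptn) : Prop :=
  ∀ i : ℕ, mu.part i ≤ lam.part i ∧ lam.part (i + 1) ≤ mu.part i
/-- Chains of partitions `μ = c 0 ≺ c 1 ≺ ⋯` stabilizing at `λ`; these encode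
semistandard Young tableaux of shape `λ/μ` with entries in `{0, 1, 2, …}`. -/
def IsSchurChain (mu lam : Ptn) (c : ℕ → Ptn) : Prop :=
  c 0 = mu ∧ (∀ i, HStrip (c i) (c (i + 1))) ∧ ∃ N, ∀ i, N ≤ i → c i = lam

/-- the monomial attached to a chain: the variable `X i` records the cells added
at step `i` of the chain -/
noncomputable def chainWeight {R : Type*} [CommRing R] (X : ℕ → R) (c : ℕ → Ptn) : R :=
  ∏ᶠ i : ℕ, X i ^ ((c (i + 1)).size - (c i).size)

/-- the skew Schur function `s_{λ/μ}(X)` (which is `0` if `μ ⊄ λ`) -/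
noncomputable def skewSchur {R : Type*} [CommRing R] [TopologicalSpace R]
    (X : ℕ → R) (lam mu : Ptn) : R :=
  ∑' c : {c : ℕ → Ptn // IsSchurChain mu lam c}, chainWeight X c.1

/-- `Ψ(X,Y) = ∏_{i,j} (1 - x_i y_j)⁻¹` -/
noncomputable def Psi {R : Type*} [CommRing R] [TopologicalSpace R] [Inv R] (X Y : ℕ → R) : R :=
  ∏' p : ℕ × ℕ, (1 - X p.1 * Y p.2)⁻¹

/-- `Φ(X) = ∏_i (1 - x_i)⁻¹ ∏_{i<j} (1 - x_i x_j)⁻¹` -/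
noncomputable def Phi {R : Type*} [CommRing R] [TopologicalSpace R] [Inv R] (X : ℕ → R) : R :=
  (∏' i : ℕ, (1 - X i)⁻¹) * ∏' p : {q : ℕ × ℕ // q.1 < q.2}, (1 - X p.1.1 * X p.1.2)⁻¹
/-- the coefficientwise (product) topology on multivariate formal power series -/
instance (σ : Type*) : TopologicalSpace (MvPowerSeries σ ℚ) :=
  inferInstanceAs (TopologicalSpace ((σ →₀ ℕ) → ℚ))

/-- the ambient ring: formal power series in the independent variables
`x_0, x_1, …`, `y_0, y_1, …` and `z` -/
abbrev R4 : Type := MvPowerSeries ((Bool × ℕ) ⊕ Unit) ℚ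

/-- the alphabet `X = {x_0, x_1, …}` -/
noncomputable def Xa (n : ℕ) : R4 := MvPowerSeries.X (Sum.inl (false, n))

/-- the alphabet `Y = {y_0, y_1, …}` -/
noncomputable def Ya (n : ℕ) : R4 := MvPowerSeries.X (Sum.inl (true, n))

/-- the extra formal variable `z` -/
noncomputable def z : R4 := MvPowerSeries.X (Sum.inr ())

/-- the union (disjoint sum) `X + Y` of the two alphabets -/
noncomputable def unionXY : ℕ → R4 :=
  fun n => if n % 2 = 0 then Xa (n / 2) else Ya (n / 2)

section

open scoped ENNReal
open MvPowerSeries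

/-- the coefficientwise topology on power series with coefficients in `[0, ∞]` -/
instance instTopologicalSpaceMvPowerSeriesENNReal (σ : Type*) :
    TopologicalSpace (MvPowerSeries σ ℝ≥0∞) :=
  inferInstanceAs (TopologicalSpace ((σ →₀ ℕ) → ℝ≥0∞))

namespace MvPowerSeries

section ENNReal

variable {σ ι κ : Type*}

instance : T3Space (MvPowerSeries σ ℝ≥0∞) :=
  inferInstanceAs (T3Space ((σ →₀ ℕ) → ℝ≥0∞))

instance : ContinuousAdd (MvPowerSeries σ ℝ≥0∞) :=
  inferInstanceAs (ContinuousAdd ((σ →₀ ℕ) → ℝ≥0∞))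

theorem summable_ennreal (f : ι → MvPowerSeries σ ℝ≥0∞) : Summable f :=
  Pi.summable (X := fun _ : σ →₀ ℕ => ℝ≥0∞).2 fun _ => ENNReal.summable

theorem coeff_tsum_ennreal (f : ι → MvPowerSeries σ ℝ≥0∞) (m : σ →₀ ℕ) :
    coeff m (∑' i, f i) = ∑' i, coeff m (f i) :=
  tsum_apply (X := fun _ : σ →₀ ℕ => ℝ≥0∞) (summable_ennreal f)

theorem tsum_mul_left_ennreal (a : MvPowerSeries σ ℝ≥0∞) (f : ι → MvPowerSeries σ ℝ≥0∞) :
    ∑' i, a * f i = a * ∑' i, f i := by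
  classical
  ext m
  simp only [coeff_tsum_ennreal, coeff_mul, ← ENNReal.tsum_mul_left]
  exact Summable.tsum_finsetSum fun _ _ => ENNReal.summable

theorem tsum_mul_right_ennreal (a : MvPowerSeries σ ℝ≥0∞) (f : ι → MvPowerSeries σ ℝ≥0∞) :
    ∑' i, f i * a = (∑' i, f i) * a := by
  simp only [mul_comm _ a, tsum_mul_left_ennreal]

theorem tsum_comm_ennreal (f : ι → κ → MvPowerSeries σ ℝ≥0∞) :
    ∑' i, ∑' k, f i k = ∑' k, ∑' i, f i k :=
  Summable.tsum_comm' (summable_ennreal _) (fun _ => summable_ennreal _)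
    fun _ => summable_ennreal _

theorem tsum_prod_ennreal (f : ι × κ → MvPowerSeries σ ℝ≥0∞) :
    ∑' p, f p = ∑' i, ∑' k, f (i, k) :=
  Summable.tsum_prod' (summable_ennreal _) fun _ => summable_ennreal _

theorem tsum_sigma_ennreal {γ : ι → Type*} (f : (Σ i, γ i) → MvPowerSeries σ ℝ≥0∞) :
    ∑' p, f p = ∑' i, ∑' k, f ⟨i, k⟩ :=
  Summable.tsum_sigma' (fun _ => summable_ennreal _) (summable_ennreal _)

end ENNReal

/-- Two power series agree on all monomials dividing a given monomial. -/
def EqUpTo {σ k : Type*} [Semiring k] (m : σ →₀ ℕ) (f g : MvPowerSeries σ k) : Prop :=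
  ∀ d ≤ m, coeff d f = coeff d g

namespace EqUpTo

variable {σ ι k : Type*} [CommSemiring k] {m : σ →₀ ℕ} {f g h f' g' : MvPowerSeries σ k}

theorem refl (m : σ →₀ ℕ) (f : MvPowerSeries σ k) : EqUpTo m f f := fun _ _ => rfl

theorem symm (h : EqUpTo m f g) : EqUpTo m g f := fun d hd => (h d hd).symm

theorem trans (h₁ : EqUpTo m f g) (h₂ : EqUpTo m g h) : EqUpTo m f h :=
  fun d hd => (h₁ d hd).trans (h₂ d hd)

theorem coeff_eq (h : EqUpTo m f g) : coeff m f = coeff m g := h m le_rfl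

theorem mul (h₁ : EqUpTo m f f') (h₂ : EqUpTo m g g') : EqUpTo m (f * g) (f' * g') := by
  classical
  intro d hd
  simp only [coeff_mul]
  refine Finset.sum_congr rfl fun p hp => ?_
  have hp' := Finset.HasAntidiagonal.mem_antidiagonal.1 hp
  rw [h₁ p.1 (le_trans (hp' ▸ le_self_add) hd), h₂ p.2 (le_trans (hp' ▸ le_add_self) hd)]

theorem add (h₁ : EqUpTo m f f') (h₂ : EqUpTo m g g') : EqUpTo m (f + g) (f' + g') := by
  intro d hd
  simp only [map_add, h₁ d hd, h₂ d hd]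

theorem pow (h : EqUpTo m f g) (n : ℕ) : EqUpTo m (f ^ n) (g ^ n) := by
  induction n with
  | zero => simpa using refl m 1
  | succ n ih => simpa only [pow_succ] using ih.mul h

theorem prod {F G : ι → MvPowerSeries σ k} (s : Finset ι) (h : ∀ i ∈ s, EqUpTo m (F i) (G i)) :
    EqUpTo m (∏ i ∈ s, F i) (∏ i ∈ s, G i) := by
  classical
  induction s using Finset.induction_on with
  | empty => exact refl m _
  | insert i s hi ih =>
    rw [Finset.prod_insert hi, Finset.prod_insert hi]
    exact (h i (Finset.mem_insert_self i s)).mul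
      (ih fun j hj => h j (Finset.mem_insert_of_mem hj))

theorem tsum {F G : ι → MvPowerSeries σ ℝ≥0∞} (h : ∀ i, EqUpTo m (F i) (G i)) :
    EqUpTo m (∑' i, F i) (∑' i, G i) := by
  intro d hd
  simp only [coeff_tsum_ennreal, fun i => h i d hd]

theorem map {l : Type*} [CommSemiring l] (φ : k →+* l) (h : EqUpTo m f g) :
    EqUpTo m (MvPowerSeries.map φ f) (MvPowerSeries.map φ g) := by
  intro d hd
  simp only [coeff_map, h d hd]

theorem mul_zero_left (h : EqUpTo m f 0) (g : MvPowerSeries σ k) : EqUpTo m (f * g) 0 := by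
  simpa using h.mul (refl m g)

theorem mul_zero_right (h : EqUpTo m f 0) (g : MvPowerSeries σ k) : EqUpTo m (g * f) 0 := by
  simpa using (refl m g).mul h

end EqUpTo

/-- The geometric series `∑ fⁱ`, for `f` without constant term. -/
noncomputable def geo {σ k : Type*} [CommSemiring k] (f : MvPowerSeries σ k) :
    MvPowerSeries σ k :=
  fun m => ∑ i ∈ Finset.range (m.degree + 1), coeff m (f ^ i)

section geo

variable {σ k l : Type*} [CommSemiring k] [CommSemiring l]

theorem coeff_pow_eq_zero_of_degree_lt {f : MvPowerSeries σ k} (hf : constantCoeff f = 0)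
    {m : σ →₀ ℕ} {n : ℕ} (h : m.degree < n) : coeff m (f ^ n) = 0 :=
  coeff_eq_zero_of_constantCoeff_nilpotent (m := 1) (by simpa using hf) (by omega)

theorem coeff_geo {f : MvPowerSeries σ k} (hf : constantCoeff f = 0) {m : σ →₀ ℕ} {n : ℕ}
    (h : m.degree < n) : coeff m (geo f) = ∑ i ∈ Finset.range n, coeff m (f ^ i) := by
  refine Finset.sum_subset (Finset.range_subset_range.2 h) fun i _ hi => ?_
  exact coeff_pow_eq_zero_of_degree_lt hf (not_lt.1 (Finset.mem_range.not.1 hi))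

theorem geo_eq {f : MvPowerSeries σ k} (hf : constantCoeff f = 0) : geo f = 1 + f * geo f := by
  classical
  ext m
  have h1 : coeff m (f * geo f) = ∑ i ∈ Finset.range (m.degree + 1), coeff m (f ^ (i + 1)) := by
    simp only [pow_succ', coeff_mul]
    rw [Finset.sum_comm]
    refine Finset.sum_congr rfl fun p hp => ?_
    rw [← Finset.mul_sum, coeff_geo hf]
    have := congrArg Finsupp.degree (Finset.HasAntidiagonal.mem_antidiagonal.1 hp)
    rw [map_add] at this
    omega
  rw [map_add, h1, coeff_geo hf (n := m.degree + 2) (by omega), Finset.sum_range_succ', add_comm,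
    pow_zero]

theorem map_geo (φ : k →+* l) (f : MvPowerSeries σ k) : map φ (geo f) = geo (map φ f) := by
  ext m
  rw [coeff_map]
  change φ (∑ i ∈ Finset.range (m.degree + 1), coeff m (f ^ i)) =
    ∑ i ∈ Finset.range (m.degree + 1), coeff m (map φ f ^ i)
  simp only [map_sum, ← map_pow, coeff_map]

theorem tsum_pow_eq_geo {f : MvPowerSeries σ ℝ≥0∞} (hf : constantCoeff f = 0) :
    ∑' i : ℕ, f ^ i = geo f := by
  ext m
  rw [coeff_tsum_ennreal, coeff_geo hf (Nat.lt_succ_self _)]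
  refine tsum_eq_sum fun i hi => coeff_pow_eq_zero_of_degree_lt hf ?_
  exact not_lt.1 (Finset.mem_range.not.1 hi)

theorem inv_one_sub_eq_geo {k : Type*} [Field k] {f : MvPowerSeries σ k}
    (hf : constantCoeff f = 0) : (1 - f)⁻¹ = geo f := by
  refine ((MvPowerSeries.eq_inv_iff_mul_eq_one (by simp [hf])).2 ?_).symm
  rw [mul_sub, mul_one, mul_comm]
  exact sub_eq_of_eq_add (geo_eq hf)

theorem EqUpTo.geo {m : σ →₀ ℕ} {f : MvPowerSeries σ k} (h : EqUpTo m f 0) :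
    EqUpTo m (geo f) 1 := by
  have hf : constantCoeff f = 0 := by simpa using h 0 (zero_le)
  rw [geo_eq hf]
  simpa using (EqUpTo.refl m 1).add (h.mul_zero_left _)

end geo

end MvPowerSeries

namespace Ptn

@[ext]
theorem ext {mu nu : Ptn} (h : ∀ i, mu.part i = nu.part i) : mu = nu := by
  obtain ⟨f, hf⟩ := mu
  obtain ⟨g, hg⟩ := nu
  obtain rfl : f = g := Finsupp.ext h
  rfl

theorem part_antitone (mu : Ptn) : Antitone mu.part := mu.antitone'

theorem part_eq_zero_of_le {mu : Ptn} {m n : ℕ} (h : mu.part m = 0) (hmn : m ≤ n) :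
    mu.part n = 0 :=
  Nat.le_zero.1 (h ▸ mu.part_antitone hmn)

theorem exists_part_eq_zero (mu : Ptn) : ∃ N, mu.part N = 0 := by
  obtain ⟨N, hN⟩ := Infinite.exists_notMem_finset mu.toFun.support
  exact ⟨N, Finsupp.notMem_support_iff.1 hN⟩

theorem size_eq_sum {mu : Ptn} {N : ℕ} (h : mu.part N = 0) :
    mu.size = ∑ i ∈ Finset.range N, mu.part i := by
  refine Finsupp.sum_of_support_subset _ (fun i hi => ?_) _ (by simp)
  rw [Finset.mem_range]
  by_contra hN
  exact Finsupp.mem_support_iff.1 hi (part_eq_zero_of_le h (not_lt.1 hN))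

theorem exists_part_eq_zero₂ (mu nu : Ptn) : ∃ N, mu.part N = 0 ∧ nu.part N = 0 := by
  obtain ⟨M, hM⟩ := mu.exists_part_eq_zero
  obtain ⟨N, hN⟩ := nu.exists_part_eq_zero
  exact ⟨max M N, part_eq_zero_of_le hM (le_max_left _ _),
    part_eq_zero_of_le hN (le_max_right _ _)⟩

theorem size_le_size {mu nu : Ptn} (h : ∀ i, mu.part i ≤ nu.part i) : mu.size ≤ nu.size := by
  obtain ⟨N, hN⟩ := nu.exists_part_eq_zero
  rw [size_eq_sum hN, size_eq_sum (Nat.le_zero.1 (hN ▸ h N))]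
  exact Finset.sum_le_sum fun i _ => h i

theorem eq_of_size_eq {mu nu : Ptn} (h : ∀ i, mu.part i ≤ nu.part i) (hs : mu.size = nu.size) :
    mu = nu := by
  obtain ⟨N, hN⟩ := nu.exists_part_eq_zero
  have hN' : mu.part N = 0 := Nat.le_zero.1 (hN ▸ h N)
  rw [size_eq_sum hN, size_eq_sum hN'] at hs
  ext i
  rcases lt_or_ge i N with hi | hi
  · exact (Finset.sum_eq_sum_iff_of_le fun i _ => h i).1 hs i (Finset.mem_range.2 hi)
  · rw [part_eq_zero_of_le hN hi, part_eq_zero_of_le hN' hi]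

theorem lt_size_of_part_ne_zero {mu : Ptn} {n : ℕ} (h : mu.part n ≠ 0) : n < mu.size := by
  obtain ⟨N, hN⟩ := mu.exists_part_eq_zero
  have hnN : n < N := by
    by_contra hn
    exact h (part_eq_zero_of_le hN (not_lt.1 hn))
  rw [size_eq_sum hN]
  calc n + 1 = ∑ i ∈ Finset.range (n + 1), 1 := by simp
    _ ≤ ∑ i ∈ Finset.range (n + 1), mu.part i := Finset.sum_le_sum fun i hi =>
        (Nat.one_le_iff_ne_zero.2 h).trans (mu.part_antitone (Finset.mem_range_succ_iff.1 hi))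
    _ ≤ ∑ i ∈ Finset.range N, mu.part i :=
        Finset.sum_le_sum_of_subset (Finset.range_subset_range.2 hnN)

/-- The partition with a given sequence of parts. -/
noncomputable def ofSeq (f : ℕ → ℕ) (hf : ∀ i, f (i + 1) ≤ f i) (h0 : ∃ N, f N = 0) : Ptn where
  toFun := Finsupp.ofSupportFinite f (by
    obtain ⟨N, hN⟩ := h0
    refine (Set.finite_lt_nat N).subset fun i hi => ?_
    by_contra h
    exact hi (Nat.le_zero.1 (hN ▸ antitone_nat_of_succ_le hf (not_lt.1 h))))
  antitone' := antitone_nat_of_succ_le hf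

@[simp]
theorem part_ofSeq (f : ℕ → ℕ) (hf : ∀ i, f (i + 1) ≤ f i) (h0 : ∃ N, f N = 0) (i : ℕ) :
    (ofSeq f hf h0).part i = f i := rfl

end Ptn

theorem HStrip.size_le {mu lam : Ptn} (h : HStrip mu lam) : mu.size ≤ lam.size :=
  Ptn.size_le_size fun i => (h i).1

theorem HStrip.refl (mu : Ptn) : HStrip mu mu :=
  fun i => ⟨le_rfl, mu.part_antitone (Nat.le_succ i)⟩

theorem HStrip.eq_of_size_eq {mu lam : Ptn} (h : HStrip mu lam) (hs : mu.size = lam.size) :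
    mu = lam :=
  Ptn.eq_of_size_eq (fun i => (h i).1) hs

/-- Reflecting each part in its interval of admissible values exchanges the common upper
neighbours of two partitions, up to a shift of the first part, with their common lower
neighbours. -/
noncomputable def hStripReflect (mu nu : Ptn) :
    {lam : Ptn // HStrip mu lam ∧ HStrip nu lam} ≃
      ℕ × {kap : Ptn // HStrip kap mu ∧ HStrip kap nu} where
  toFun lam := ⟨lam.1.part 0 - max (mu.part 0) (nu.part 0),
    Ptn.ofSeq (fun i => max (mu.part (i + 1)) (nu.part (i + 1)) + min (mu.part i) (nu.part i)
        - lam.1.part (i + 1))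
      (fun i => by
        have h1 := lam.2.1 (i + 1)
        have h2 := lam.2.2 (i + 1)
        have h3 := lam.2.1 i
        have h4 := lam.2.2 i
        have h5 := lam.2.1 (i + 2)
        have h6 := lam.2.2 (i + 2)
        grind)
      (by
        obtain ⟨N, h1, h2⟩ := Ptn.exists_part_eq_zero₂ mu nu
        have := Ptn.part_eq_zero_of_le h1 (Nat.le_succ N)
        have := Ptn.part_eq_zero_of_le h2 (Nat.le_succ N)
        exact ⟨N, by grind⟩),
    fun i => by
      have h1 := lam.2.1 (i + 1)
      have h2 := lam.2.2 (i + 1)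
      have h3 := lam.2.1 i
      have h4 := lam.2.2 i
      simp only [Ptn.part_ofSeq]
      grind,
    fun i => by
      have h1 := lam.2.1 (i + 1)
      have h2 := lam.2.2 (i + 1)
      have h3 := lam.2.1 i
      have h4 := lam.2.2 i
      simp only [Ptn.part_ofSeq]
      grind⟩
  invFun p := ⟨Ptn.ofSeq (fun i => if i = 0 then max (mu.part 0) (nu.part 0) + p.1
        else max (mu.part i) (nu.part i) + min (mu.part (i - 1)) (nu.part (i - 1))
          - p.2.1.part (i - 1))
      (fun i => by
        cases i with
        | zero =>
          have h1 := p.2.2.1 0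
          have h2 := p.2.2.2 0
          grind
        | succ i =>
          have h1 := p.2.2.1 (i + 1)
          have h2 := p.2.2.2 (i + 1)
          have h3 := p.2.2.1 i
          have h4 := p.2.2.2 i
          grind)
      (by
        obtain ⟨N, h1, h2⟩ := Ptn.exists_part_eq_zero₂ mu nu
        have := Ptn.part_eq_zero_of_le h1 (Nat.le_succ N)
        have := Ptn.part_eq_zero_of_le h2 (Nat.le_succ N)
        exact ⟨N + 1, by grind⟩),
    fun i => by
      have h3 := p.2.2.1 i
      have h4 := p.2.2.2 i
      cases i with
      | zero => simp only [Ptn.part_ofSeq]; grind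
      | succ i =>
        have h1 := p.2.2.1 i
        have h2 := p.2.2.2 i
        simp only [Ptn.part_ofSeq]
        grind,
    fun i => by
      have h3 := p.2.2.1 i
      have h4 := p.2.2.2 i
      cases i with
      | zero => simp only [Ptn.part_ofSeq]; grind
      | succ i =>
        have h1 := p.2.2.1 i
        have h2 := p.2.2.2 i
        simp only [Ptn.part_ofSeq]
        grind⟩
  left_inv lam := by
    ext i
    cases i with
    | zero =>
      have h1 := lam.2.1 0
      have h2 := lam.2.2 0
      simp only [Ptn.part_ofSeq]
      grind
    | succ i =>
      have h1 := lam.2.1 (i + 1)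
      have h2 := lam.2.2 (i + 1)
      have h3 := lam.2.1 i
      have h4 := lam.2.2 i
      simp only [Ptn.part_ofSeq]
      grind
  right_inv p := by
    refine Prod.ext ?_ (Subtype.ext (Ptn.ext fun i => ?_))
    · simp [Ptn.part_ofSeq]
    · have h3 := p.2.2.1 i
      have h4 := p.2.2.2 i
      simp only [Ptn.part_ofSeq]
      grind

theorem size_add_size_hStripReflect (mu nu : Ptn)
    (lam : {lam : Ptn // HStrip mu lam ∧ HStrip nu lam}) :
    lam.1.size + (hStripReflect mu nu lam).2.1.size
      = mu.size + nu.size + (hStripReflect mu nu lam).1 := by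
  obtain ⟨N, h1, h2⟩ := Ptn.exists_part_eq_zero₂ mu nu
  obtain ⟨lam, hl⟩ := lam
  have hkap : (hStripReflect mu nu ⟨lam, hl⟩).2.1.part N = 0 := by
    have := ((hStripReflect mu nu ⟨lam, hl⟩).2.2.1 N).1
    omega
  have hlam : lam.part (N + 1) = 0 := by
    have := (hl.1 N).2
    omega
  have key : ∀ i, lam.part (i + 1) + (hStripReflect mu nu ⟨lam, hl⟩).2.1.part i
      = max (mu.part (i + 1)) (nu.part (i + 1)) + min (mu.part i) (nu.part i) := by
    intro i
    have h1 := hl.1 (i + 1)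
    have h2 := hl.2 (i + 1)
    have h3 := hl.1 i
    have h4 := hl.2 i
    simp only [hStripReflect, Equiv.coe_fn_mk, Ptn.part_ofSeq]
    grind
  have key0 : lam.part 0 = max (mu.part 0) (nu.part 0) + (hStripReflect mu nu ⟨lam, hl⟩).1 := by
    have h3 := hl.1 0
    have h4 := hl.2 0
    simp only [hStripReflect, Equiv.coe_fn_mk]
    grind
  have hmax : ∑ i ∈ Finset.range N, max (mu.part (i + 1)) (nu.part (i + 1))
      + max (mu.part 0) (nu.part 0) = ∑ i ∈ Finset.range N, max (mu.part i) (nu.part i) := by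
    rw [← Finset.sum_range_succ' (fun i => max (mu.part i) (nu.part i)), Finset.sum_range_succ,
      h1, h2, max_self, add_zero]
  have hsum := Finset.sum_congr (rfl : Finset.range N = _) fun i _ => key i
  have hmm := Finset.sum_congr (rfl : Finset.range N = _)
    fun i _ => max_add_min (mu.part i) (nu.part i)
  simp only [Finset.sum_add_distrib] at hsum hmm
  rw [Ptn.size_eq_sum h1, Ptn.size_eq_sum h2, Ptn.size_eq_sum hkap, Ptn.size_eq_sum hlam,
    Finset.sum_range_succ', key0]
  omega

/-- Removing all columns of maximal length. -/
noncomputable def removeColumns (n : ℕ) :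
    {mu : Ptn // mu.part (n + 1) = 0} ≃ ℕ × {mu : Ptn // mu.part n = 0} where
  toFun mu := ⟨mu.1.part n, Ptn.ofSeq (fun i => mu.1.part i - mu.1.part n)
    (fun i => Nat.sub_le_sub_right (mu.1.part_antitone (Nat.le_succ i)) _) ⟨n, Nat.sub_self _⟩,
    Nat.sub_self _⟩
  invFun p := ⟨Ptn.ofSeq (fun i => p.2.1.part i + if i ≤ n then p.1 else 0)
    (fun i => by
      have := p.2.1.part_antitone (Nat.le_succ i)
      grind)
    ⟨n + 1, by
      have := Ptn.part_eq_zero_of_le p.2.2 (Nat.le_succ n)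
      grind⟩, by
      have := Ptn.part_eq_zero_of_le p.2.2 (Nat.le_succ n)
      simp only [Ptn.part_ofSeq]
      grind⟩
  left_inv mu := by
    ext i
    simp only [Ptn.part_ofSeq]
    split_ifs with h
    · exact Nat.sub_add_cancel (mu.1.part_antitone h)
    · rw [Ptn.part_eq_zero_of_le mu.2 (not_le.1 h), Nat.zero_sub]
  right_inv p := by
    refine Prod.ext ?_ (Subtype.ext (Ptn.ext fun i => ?_))
    · simp [p.2.2]
    · simp only [Ptn.part_ofSeq]
      have h0 := p.2.2
      by_cases h : i ≤ n
      · simp [h, h0]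
      · simp [h, h0, Ptn.part_eq_zero_of_le h0 (not_le.1 h).le]

theorem size_removeColumns_symm (n : ℕ) (p : ℕ × {mu : Ptn // mu.part n = 0}) :
    ((removeColumns n).symm p).1.size = (n + 1) * p.1 + p.2.1.size := by
  rw [Ptn.size_eq_sum ((removeColumns n).symm p).2,
    Ptn.size_eq_sum (Ptn.part_eq_zero_of_le p.2.2 (Nat.le_succ n))]
  have : ∀ i ∈ Finset.range (n + 1), ((removeColumns n).symm p).1.part i = p.2.1.part i + p.1 :=
    fun i hi => by
      simp only [removeColumns, Equiv.coe_fn_symm_mk, Ptn.part_ofSeq,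
        if_pos (Finset.mem_range_succ_iff.1 hi)]
  rw [Finset.sum_congr rfl this, Finset.sum_add_distrib, add_comm]
  simp

open Classical in
/-- The skew Schur function of shape `λ/μ` in a single variable. -/
noncomputable def stripWeight {R : Type*} [CommSemiring R] (a : R) (mu lam : Ptn) : R :=
  if HStrip mu lam then a ^ (lam.size - mu.size) else 0

/-- The product `∏ g(aᵢ) ∏_{i<j} g(aᵢ aⱼ)` over a finite alphabet. -/
def phiList {R : Type*} [CommMonoid R] (g : R → R) : List R → R
  | [] => 1
  | a :: l => g a * (l.map fun b => g (a * b)).prod * phiList g l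

section

variable {σ : Type*}

theorem tsum_stripWeight_mul_stripWeight (a b : MvPowerSeries σ ℝ≥0∞) (mu nu : Ptn) :
    ∑' lam, stripWeight a mu lam * stripWeight b nu lam
      = (∑' k : ℕ, (a * b) ^ k) * ∑' kap, stripWeight b kap mu * stripWeight a kap nu := by
  have h1 : ∑' lam, stripWeight a mu lam * stripWeight b nu lam =
      ∑' lam : {lam // HStrip mu lam ∧ HStrip nu lam},
        a ^ (lam.1.size - mu.size) * b ^ (lam.1.size - nu.size) := by
    rw [← tsum_subtype_eq_of_support_subset (s := {lam | HStrip mu lam ∧ HStrip nu lam})]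
    · exact tsum_congr fun lam => by rw [stripWeight, stripWeight, if_pos lam.2.1, if_pos lam.2.2]
    · intro lam hlam
      by_contra h
      rcases not_and_or.1 h with h | h <;> simp [stripWeight, h] at hlam
  have h2 : ∑' kap, stripWeight b kap mu * stripWeight a kap nu =
      ∑' kap : {kap // HStrip kap mu ∧ HStrip kap nu},
        b ^ (mu.size - kap.1.size) * a ^ (nu.size - kap.1.size) := by
    rw [← tsum_subtype_eq_of_support_subset (s := {kap | HStrip kap mu ∧ HStrip kap nu})]
    · exact tsum_congr fun kap => by rw [stripWeight, stripWeight, if_pos kap.2.1, if_pos kap.2.2]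
    · intro kap hkap
      by_contra h
      rcases not_and_or.1 h with h | h <;> simp [stripWeight, h] at hkap
  rw [h1, h2, ← tsum_mul_right_ennreal]
  simp only [← tsum_mul_left_ennreal]
  rw [← tsum_prod_ennreal (fun p : ℕ × {kap // HStrip kap mu ∧ HStrip kap nu} =>
    (a * b) ^ p.1 * (b ^ (mu.size - p.2.1.size) * a ^ (nu.size - p.2.1.size))),
    ← (hStripReflect mu nu).tsum_eq]
  refine tsum_congr fun lam => ?_
  have hs := size_add_size_hStripReflect mu nu lam
  have h1 := lam.2.1.size_le
  have h2 := lam.2.2.size_le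
  have h3 := (hStripReflect mu nu lam).2.2.1.size_le
  have h4 := (hStripReflect mu nu lam).2.2.2.size_le
  rw [show lam.1.size - mu.size = (hStripReflect mu nu lam).1
      + (nu.size - (hStripReflect mu nu lam).2.1.size) by omega,
    show lam.1.size - nu.size = (hStripReflect mu nu lam).1
      + (mu.size - (hStripReflect mu nu lam).2.1.size) by omega]
  ring

theorem tsum_stripWeight (a : MvPowerSeries σ ℝ≥0∞) (mu : Ptn) :
    ∑' lam, stripWeight a mu lam = (∑' k : ℕ, a ^ k) * ∑' kap, stripWeight a kap mu := by
  have h1 : ∀ lam, stripWeight a mu lam * stripWeight 1 mu lam = stripWeight a mu lam := by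
    intro lam
    by_cases h : HStrip mu lam <;> simp [stripWeight, h]
  have h2 : ∀ kap, stripWeight 1 kap mu * stripWeight a kap mu = stripWeight a kap mu := by
    intro kap
    by_cases h : HStrip kap mu <;> simp [stripWeight, h]
  simpa only [h1, h2, mul_one] using tsum_stripWeight_mul_stripWeight a 1 mu mu

open Classical in
/-- The skew Schur polynomial of shape `λ/μ` in a finite alphabet. -/
noncomputable def listSchur :
    List (MvPowerSeries σ ℝ≥0∞) → Ptn → Ptn → MvPowerSeries σ ℝ≥0∞
  | [], mu, lam => if mu = lam then 1 else 0
  | a :: l, mu, lam => ∑' kap, stripWeight a mu kap * listSchur l kap lam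

theorem tsum_listSchur_nil_mul (mu : Ptn) (f : Ptn → MvPowerSeries σ ℝ≥0∞) :
    ∑' kap, listSchur [] mu kap * f kap = f mu := by
  rw [tsum_eq_single mu fun kap h => by simp [listSchur, h.symm]]
  simp [listSchur]

theorem tsum_listSchur_nil_mul' (mu : Ptn) (f : Ptn → MvPowerSeries σ ℝ≥0∞) :
    ∑' kap, listSchur [] kap mu * f kap = f mu := by
  rw [tsum_eq_single mu fun kap h => by simp [listSchur, h]]
  simp [listSchur]

theorem listSchur_append (l l' : List (MvPowerSeries σ ℝ≥0∞)) (mu lam : Ptn) :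
    listSchur (l ++ l') mu lam = ∑' kap, listSchur l mu kap * listSchur l' kap lam := by
  induction l generalizing mu with
  | nil => rw [List.nil_append, tsum_listSchur_nil_mul]
  | cons a l ih =>
    simp only [List.cons_append, listSchur, ih, ← tsum_mul_left_ennreal, ← tsum_mul_right_ennreal]
    rw [tsum_comm_ennreal]
    simp only [mul_assoc]

theorem tsum_stripWeight_mul_listSchur (a : MvPowerSeries σ ℝ≥0∞)
    (l : List (MvPowerSeries σ ℝ≥0∞)) (mu nu : Ptn) :
    ∑' kap, stripWeight a mu kap * listSchur l nu kap
      = (l.map fun b => ∑' k : ℕ, (a * b) ^ k).prod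
        * ∑' kap, listSchur l kap mu * stripWeight a kap nu := by
  induction l generalizing nu with
  | nil =>
    rw [tsum_listSchur_nil_mul', List.map_nil, List.prod_nil, one_mul]
    simp only [mul_comm (stripWeight _ _ _)]
    rw [tsum_listSchur_nil_mul]
  | cons b l ih =>
    calc ∑' kap, stripWeight a mu kap * listSchur (b :: l) nu kap
        = ∑' tau, stripWeight b nu tau * ∑' kap, stripWeight a mu kap * listSchur l tau kap := by
          simp only [listSchur, ← tsum_mul_left_ennreal]
          rw [tsum_comm_ennreal]
          simp only [mul_left_comm]
      _ = (l.map fun b => ∑' k : ℕ, (a * b) ^ k).prod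
          * ∑' kap, listSchur l kap mu * ∑' tau, stripWeight a kap tau * stripWeight b nu tau := by
          simp only [ih, ← tsum_mul_left_ennreal]
          rw [tsum_comm_ennreal]
          refine tsum_congr fun _ => tsum_congr fun _ => ?_
          ring
      _ = _ := by
          have h : ∑' kap, listSchur (b :: l) kap mu * stripWeight a kap nu
              = ∑' kap, listSchur l kap mu
                * ∑' rho, stripWeight b rho kap * stripWeight a rho nu := by
            simp only [listSchur, ← tsum_mul_left_ennreal, ← tsum_mul_right_ennreal]
            rw [tsum_comm_ennreal]
            refine tsum_congr fun _ => tsum_congr fun _ => ?_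
            ring
          simp only [h, tsum_stripWeight_mul_stripWeight, List.map_cons, List.prod_cons,
            mul_left_comm (listSchur _ _ _), tsum_mul_left_ennreal]
          ring

theorem tsum_listSchur (l : List (MvPowerSeries σ ℝ≥0∞)) (mu : Ptn) :
    ∑' lam, listSchur l mu lam
      = phiList (fun a => ∑' k : ℕ, a ^ k) l * ∑' nu, listSchur l nu mu := by
  induction l generalizing mu with
  | nil =>
    have h1 := tsum_listSchur_nil_mul (σ := σ) mu 1
    have h2 := tsum_listSchur_nil_mul' (σ := σ) mu 1
    simp only [Pi.one_apply, mul_one] at h1 h2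
    rw [h1, h2, phiList, one_mul]
  | cons a l ih =>
    calc ∑' lam, listSchur (a :: l) mu lam
        = ∑' kap, stripWeight a mu kap * ∑' lam, listSchur l kap lam := by
          simp only [listSchur]
          rw [tsum_comm_ennreal]
          simp only [tsum_mul_left_ennreal]
      _ = phiList (fun a => ∑' k : ℕ, a ^ k) l
          * ∑' nu, ∑' kap, stripWeight a mu kap * listSchur l nu kap := by
          simp only [ih, ← tsum_mul_left_ennreal]
          rw [tsum_comm_ennreal]
          simp only [mul_left_comm]
      _ = phiList (fun a => ∑' k : ℕ, a ^ k) l * (l.map fun b => ∑' k : ℕ, (a * b) ^ k).prod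
          * ∑' kap, listSchur l kap mu * ∑' nu, stripWeight a kap nu := by
          simp only [tsum_stripWeight_mul_listSchur, tsum_mul_left_ennreal]
          rw [tsum_comm_ennreal]
          simp only [tsum_mul_left_ennreal, mul_assoc]
      _ = _ := by
          simp only [tsum_stripWeight, listSchur, phiList]
          rw [tsum_comm_ennreal]
          simp only [mul_left_comm (listSchur _ _ _), tsum_mul_left_ennreal,
            tsum_mul_right_ennreal, mul_comm (listSchur _ _ _)]
          ring

/-- The generating function `∑ z^|μ| s_{μ/ν}` over all pairs of partitions. -/
noncomputable def schurTotal (t : MvPowerSeries σ ℝ≥0∞) (l : List (MvPowerSeries σ ℝ≥0∞)) :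
    MvPowerSeries σ ℝ≥0∞ :=
  ∑' nu, ∑' mu : Ptn, t ^ mu.size * listSchur l nu mu

theorem pow_size_mul_listSchur (t : MvPowerSeries σ ℝ≥0∞) (l : List (MvPowerSeries σ ℝ≥0∞))
    (nu mu : Ptn) :
    t ^ mu.size * listSchur l nu mu = t ^ nu.size * listSchur (l.map (t * ·)) nu mu := by
  induction l generalizing nu with
  | nil => by_cases h : nu = mu <;> simp [listSchur, h]
  | cons a l ih =>
    simp only [listSchur, List.map_cons, ← tsum_mul_left_ennreal]
    refine tsum_congr fun kap => ?_
    rw [mul_left_comm, ih, stripWeight, stripWeight]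
    split_ifs with h
    · rw [mul_pow, ← mul_assoc, ← mul_assoc, ← mul_assoc, ← pow_add, mul_comm (a ^ _),
        Nat.add_sub_cancel' h.size_le]
    · simp

theorem schurTotal_eq (t : MvPowerSeries σ ℝ≥0∞) (l : List (MvPowerSeries σ ℝ≥0∞)) :
    schurTotal t l = phiList (fun a => ∑' k : ℕ, a ^ k) (l.map (t * ·))
      * schurTotal t (l.map (t * ·)) := by
  simp only [schurTotal, pow_size_mul_listSchur t l, tsum_mul_left_ennreal]
  simp only [tsum_listSchur, mul_left_comm (_ ^ _), tsum_mul_left_ennreal]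
  congr 1
  simp only [← tsum_mul_left_ennreal]
  rw [tsum_comm_ennreal]

theorem schurTotal_eq_prod_mul (t : MvPowerSeries σ ℝ≥0∞) (l : List (MvPowerSeries σ ℝ≥0∞))
    (n : ℕ) :
    schurTotal t l = (∏ k ∈ Finset.range n,
        phiList (fun a => ∑' k : ℕ, a ^ k) (l.map (t ^ (k + 1) * ·)))
      * schurTotal t (l.map (t ^ n * ·)) := by
  induction n with
  | zero => simp
  | succ n ih =>
    rw [ih, schurTotal_eq, Finset.prod_range_succ, mul_assoc, List.map_map]
    have : (t * ·) ∘ (t ^ n * ·) = (t ^ (n + 1) * ·) := by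
      ext1 x
      simp only [Function.comp_apply]
      ring
    rw [this]

theorem tsum_listSchur_mul_listSchur (t : MvPowerSeries σ ℝ≥0∞)
    (l l' : List (MvPowerSeries σ ℝ≥0∞)) :
    ∑' lam : Ptn, ∑' mu : Ptn, ∑' gam, t ^ mu.size * listSchur l gam mu * listSchur l' gam lam
      = phiList (fun a => ∑' k : ℕ, a ^ k) l' * schurTotal t (l' ++ l) := by
  calc _ = ∑' mu : Ptn, ∑' gam, t ^ mu.size * listSchur l gam mu
        * ∑' lam, listSchur l' gam lam := by
        rw [tsum_comm_ennreal]
        refine tsum_congr fun mu => ?_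
        rw [tsum_comm_ennreal]
        simp only [tsum_mul_left_ennreal]
    _ = phiList (fun a => ∑' k : ℕ, a ^ k) l' * ∑' mu : Ptn, ∑' gam, ∑' nu,
        t ^ mu.size * (listSchur l' nu gam * listSchur l gam mu) := by
        simp only [tsum_listSchur, ← tsum_mul_left_ennreal]
        refine tsum_congr fun _ => tsum_congr fun _ => tsum_congr fun _ => ?_
        ring
    _ = _ := by
        rw [schurTotal, tsum_comm_ennreal (fun nu (mu : Ptn) => t ^ mu.size * _)]
        congr 1
        refine tsum_congr fun mu => ?_
        rw [tsum_comm_ennreal]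
        simp only [listSchur_append, tsum_mul_left_ennreal]

end

/-- The monomial attached to a chain, in a commutative semiring. -/
noncomputable def chainMonomial {R : Type*} [CommSemiring R] (X : ℕ → R) (c : ℕ → Ptn) : R :=
  ∏ᶠ i : ℕ, X i ^ ((c (i + 1)).size - (c i).size)

theorem chainMonomial_eq_prod {R : Type*} [CommSemiring R] (X : ℕ → R) {c : ℕ → Ptn} {lam : Ptn}
    {N : ℕ} (h : ∀ i, N ≤ i → c i = lam) :
    chainMonomial X c = ∏ i ∈ Finset.range N, X i ^ ((c (i + 1)).size - (c i).size) := by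
  refine finprod_eq_prod_of_mulSupport_subset _ fun i hi => ?_
  by_contra hN
  rw [Finset.coe_range, Set.mem_Iio, not_lt] at hN
  exact hi (by simp [h i hN, h (i + 1) (by omega)])

theorem map_chainMonomial {R S : Type*} [CommSemiring R] [CommSemiring S] (φ : R →+* S)
    (X : ℕ → R) {c : ℕ → Ptn} {mu lam : Ptn} (hc : IsSchurChain mu lam c) :
    φ (chainMonomial X c) = chainMonomial (fun i => φ (X i)) c := by
  obtain ⟨N, hN⟩ := hc.2.2
  rw [chainMonomial_eq_prod X hN, chainMonomial_eq_prod _ hN]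
  simp

theorem isSchurChain_const (mu : Ptn) : IsSchurChain mu mu fun _ => mu :=
  ⟨rfl, fun _ => HStrip.refl mu, 0, fun _ _ => rfl⟩

theorem chainMonomial_const {R : Type*} [CommSemiring R] (X : ℕ → R) (mu : Ptn) :
    chainMonomial X (fun _ => mu) = 1 := by
  rw [chainMonomial_eq_prod X (N := 0) fun _ _ => rfl, Finset.prod_range_zero]

theorem IsSchurChain.eq_const_of_forall_size_le {mu lam : Ptn} {c : ℕ → Ptn}
    (hc : IsSchurChain mu lam c) (h : ∀ i, (c (i + 1)).size ≤ (c i).size) :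
    c = fun _ => mu := by
  ext1 i
  induction i with
  | zero => exact hc.1
  | succ i ih =>
    rw [← ih]
    exact ((hc.2.1 i).eq_of_size_eq (le_antisymm (hc.2.1 i).size_le (h i))).symm

/-- Prepending a partition to a chain. -/
noncomputable def consChain (mu lam : Ptn) :
    (Σ kap : {kap // HStrip mu kap}, {c : ℕ → Ptn // IsSchurChain kap lam c}) ≃
      {c : ℕ → Ptn // IsSchurChain mu lam c} :=
  Equiv.ofBijective
    (fun p => ⟨fun i => Nat.casesOn i mu p.2.1, rfl, fun i => by
        cases i with
        | zero =>
          change HStrip mu (p.2.1 0)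
          rw [p.2.2.1]
          exact p.1.2
        | succ i => exact p.2.2.2.1 i, by
        obtain ⟨N, hN⟩ := p.2.2.2.2
        refine ⟨N + 1, fun i hi => ?_⟩
        obtain ⟨i, rfl⟩ := Nat.exists_eq_add_of_le' (Nat.le_of_add_left_le hi)
        exact hN i (by omega)⟩)
    ⟨fun p q h => by
        obtain ⟨⟨kap, hk⟩, c, hc⟩ := p
        obtain ⟨⟨kap', hk'⟩, c', hc'⟩ := q
        have hcc : c = c' := funext fun i => congrFun (congrArg Subtype.val h) (i + 1)
        subst hcc
        obtain rfl : kap = kap' := hc.1.symm.trans hc'.1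
        rfl,
      fun c => by
        refine ⟨⟨⟨c.1 1, ?_⟩, fun i => c.1 (i + 1), rfl, fun i => c.2.2.1 (i + 1), ?_⟩, ?_⟩
        · simpa only [c.2.1] using c.2.2.1 0
        · obtain ⟨N, hN⟩ := c.2.2.2
          exact ⟨N, fun i hi => hN (i + 1) (by omega)⟩
        · ext1
          funext i
          cases i with
          | zero => exact c.2.1.symm
          | succ i => rfl⟩

theorem chainMonomial_consChain {R : Type*} [CommSemiring R] (X : ℕ → R) (mu lam : Ptn)
    (p : Σ kap : {kap // HStrip mu kap}, {c : ℕ → Ptn // IsSchurChain kap lam c}) :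
    chainMonomial X (consChain mu lam p).1
      = X 0 ^ (p.1.1.size - mu.size) * chainMonomial (fun i => X (i + 1)) p.2.1 := by
  obtain ⟨N, hN⟩ := p.2.2.2.2
  have hN' : ∀ i, N + 1 ≤ i → (consChain mu lam p).1 i = lam := fun i hi => by
    obtain ⟨i, rfl⟩ := Nat.exists_eq_add_of_le' (Nat.le_of_add_left_le hi)
    exact hN i (by omega)
  rw [chainMonomial_eq_prod X hN', chainMonomial_eq_prod _ hN, Finset.prod_range_succ', mul_comm]
  congr 3
  exact congrArg Ptn.size p.2.2.1

section

variable {σ : Type*}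

/-- The skew Schur function with coefficients in `[0, ∞]`. -/
noncomputable def ennrealSchur (X : ℕ → MvPowerSeries σ ℝ≥0∞) (lam mu : Ptn) :
    MvPowerSeries σ ℝ≥0∞ :=
  ∑' c : {c : ℕ → Ptn // IsSchurChain mu lam c}, chainMonomial X c.1

theorem ennrealSchur_eq_tsum (X : ℕ → MvPowerSeries σ ℝ≥0∞) (lam mu : Ptn) :
    ennrealSchur X lam mu
      = ∑' kap, stripWeight (X 0) mu kap * ennrealSchur (fun i => X (i + 1)) lam kap := by
  rw [ennrealSchur, ← (consChain mu lam).tsum_eq, tsum_sigma_ennreal,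
    ← tsum_subtype_eq_of_support_subset (s := {kap | HStrip mu kap})]
  · refine tsum_congr fun kap => ?_
    rw [stripWeight, if_pos kap.2, ennrealSchur, ← tsum_mul_left_ennreal]
    exact tsum_congr fun c => chainMonomial_consChain X mu lam ⟨kap, c⟩
  · intro kap hk
    by_contra h
    have h' : ¬ HStrip mu kap := h
    simp [stripWeight, h'] at hk

theorem ennrealSchur_eq_listSchur_nil {X : ℕ → MvPowerSeries σ ℝ≥0∞} (h : ∀ i, X i = 0)
    (lam mu : Ptn) : ennrealSchur X lam mu = listSchur [] mu lam := by
  have key : ∀ c : {c : ℕ → Ptn // IsSchurChain mu lam c}, c.1 ≠ (fun _ => mu) →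
      chainMonomial X c.1 = 0 := by
    intro c hc
    by_contra h0
    refine hc (c.2.eq_const_of_forall_size_le fun i => ?_)
    by_contra hi
    obtain ⟨N, hN⟩ := c.2.2.2
    rw [chainMonomial_eq_prod X (N := max N (i + 1))
      fun j hj => hN j (le_trans (le_max_left _ _) hj)] at h0
    refine h0 (Finset.prod_eq_zero (i := i) (Finset.mem_range.2 (by omega)) ?_)
    rw [h, zero_pow (by omega)]
  rw [ennrealSchur, listSchur]
  split_ifs with hml
  · subst hml
    rw [tsum_eq_single ⟨_, isSchurChain_const mu⟩ fun c hc => key c fun h => hc (Subtype.ext h)]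
    exact chainMonomial_const X mu
  · refine (tsum_congr fun c => key c fun h => hml ?_).trans tsum_zero
    obtain ⟨N, hN⟩ := c.2.2.2
    rw [← hN N le_rfl, h]

theorem ennrealSchur_eq_listSchur {X : ℕ → MvPowerSeries σ ℝ≥0∞} {n : ℕ}
    (h : ∀ i, n ≤ i → X i = 0) (lam mu : Ptn) :
    ennrealSchur X lam mu = listSchur ((List.range n).map X) mu lam := by
  induction n generalizing X mu with
  | zero => exact ennrealSchur_eq_listSchur_nil (fun i => h i (Nat.zero_le i)) lam mu
  | succ n ih =>
    rw [ennrealSchur_eq_tsum, List.range_succ_eq_map, List.map_cons, listSchur, List.map_map]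
    refine tsum_congr fun kap => ?_
    rw [ih fun i hi => h (i + 1) (by omega)]
    rfl

variable {m : σ →₀ ℕ}

theorem ennrealSchur_eqUpTo {X X' : ℕ → MvPowerSeries σ ℝ≥0∞} (h : ∀ i, EqUpTo m (X i) (X' i))
    (lam mu : Ptn) : EqUpTo m (ennrealSchur X lam mu) (ennrealSchur X' lam mu) := by
  refine EqUpTo.tsum fun c => ?_
  obtain ⟨N, hN⟩ := c.2.2.2
  rw [chainMonomial_eq_prod X hN, chainMonomial_eq_prod X' hN]
  exact EqUpTo.prod _ fun i _ => (h i).pow _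

theorem ennrealSchur_eqUpTo_listSchur {X : ℕ → MvPowerSeries σ ℝ≥0∞} {n : ℕ}
    (h : ∀ i, n ≤ i → EqUpTo m (X i) 0) (lam mu : Ptn) :
    EqUpTo m (ennrealSchur X lam mu) (listSchur ((List.range n).map X) mu lam) := by
  have h1 := ennrealSchur_eq_listSchur (X := fun i => if i < n then X i else 0) (n := n)
    (fun i hi => if_neg (not_lt.2 hi)) lam mu
  have h2 : (List.range n).map (fun i => if i < n then X i else 0) = (List.range n).map X :=
    List.map_congr_left fun i hi => if_pos (List.mem_range.1 hi)
  rw [← h2, ← h1]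
  refine ennrealSchur_eqUpTo (fun i => ?_) lam mu
  split_ifs with hi
  · exact EqUpTo.refl m _
  · exact h i (not_lt.1 hi)

theorem stripWeight_eqUpTo_nil {a : MvPowerSeries σ ℝ≥0∞} (h : EqUpTo m a 0) (mu lam : Ptn) :
    EqUpTo m (stripWeight a mu lam) (listSchur [] mu lam) := by
  rw [stripWeight, listSchur]
  split_ifs with h1 h2 h2
  · rw [h2, Nat.sub_self, pow_zero]
    exact EqUpTo.refl m _
  · have h3 : lam.size - mu.size ≠ 0 := fun h3 =>
      h2 (h1.eq_of_size_eq (le_antisymm h1.size_le (Nat.sub_eq_zero_iff_le.1 h3)))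
    simpa [h3] using h.pow (lam.size - mu.size)
  · exact absurd (h2 ▸ HStrip.refl mu) h1
  · exact EqUpTo.refl m _

theorem listSchur_eqUpTo_nil {l : List (MvPowerSeries σ ℝ≥0∞)} (h : ∀ a ∈ l, EqUpTo m a 0)
    (mu lam : Ptn) : EqUpTo m (listSchur l mu lam) (listSchur [] mu lam) := by
  induction l generalizing mu with
  | nil => exact EqUpTo.refl m _
  | cons a l ih =>
    rw [← tsum_listSchur_nil_mul mu fun kap => listSchur [] kap lam, listSchur]
    exact EqUpTo.tsum fun kap => (stripWeight_eqUpTo_nil (h a List.mem_cons_self) mu kap).mul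
      (ih (fun b hb => h b (List.mem_cons_of_mem a hb)) kap)

theorem schurTotal_eqUpTo (t : MvPowerSeries σ ℝ≥0∞) {l : List (MvPowerSeries σ ℝ≥0∞)}
    (h : ∀ a ∈ l, EqUpTo m a 0) :
    EqUpTo m (schurTotal t l) (∑' mu : Ptn, t ^ mu.size) := by
  have : ∑' mu : Ptn, t ^ mu.size = schurTotal t [] := by
    rw [schurTotal]
    refine tsum_congr fun nu => ?_
    simp only [mul_comm (t ^ _)]
    rw [tsum_listSchur_nil_mul nu fun mu => t ^ mu.size]
  rw [this]
  exact EqUpTo.tsum fun nu => EqUpTo.tsum fun mu =>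
    (EqUpTo.refl m _).mul (listSchur_eqUpTo_nil h nu mu)

theorem tsum_pow_size_of_part_eq_zero (t : MvPowerSeries σ ℝ≥0∞) (n : ℕ) :
    ∑' mu : {mu : Ptn // mu.part n = 0}, t ^ mu.1.size
      = ∏ k ∈ Finset.range n, ∑' j : ℕ, (t ^ (k + 1)) ^ j := by
  induction n with
  | zero =>
    have hs : ∀ mu : {mu : Ptn // mu.part 0 = 0}, mu.1.size = 0 := fun mu => by
      rw [Ptn.size_eq_sum mu.2, Finset.sum_range_zero]
    rw [tsum_eq_single ⟨Ptn.ofSeq (fun _ => 0) (fun _ => le_rfl) ⟨0, rfl⟩, rfl⟩, hs, pow_zero,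
      Finset.prod_range_zero]
    refine fun mu hmu => absurd (Subtype.ext (Ptn.ext fun i => ?_)) hmu
    exact Ptn.part_eq_zero_of_le mu.2 (Nat.zero_le i)
  | succ n ih =>
    rw [Finset.prod_range_succ, ← ih, ← (removeColumns n).symm.tsum_eq, tsum_prod_ennreal,
      ← tsum_mul_left_ennreal]
    refine tsum_congr fun k => ?_
    rw [← tsum_mul_right_ennreal]
    refine tsum_congr fun mu => ?_
    rw [size_removeColumns_symm, pow_add, pow_mul, mul_comm]

theorem tsum_pow_size_eqUpTo {t : MvPowerSeries σ ℝ≥0∞} {n : ℕ} (h : EqUpTo m (t ^ n) 0) :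
    EqUpTo m (∑' mu : Ptn, t ^ mu.size)
      (∏ k ∈ Finset.range n, ∑' j : ℕ, (t ^ (k + 1)) ^ j) := by
  classical
  have h1 : ∑' mu : {mu : Ptn // mu.part n = 0}, t ^ mu.1.size
      = ∑' mu : Ptn, if mu.part n = 0 then t ^ mu.size else 0 := by
    refine (tsum_subtype {mu : Ptn | mu.part n = 0} fun mu => t ^ mu.size).trans ?_
    exact tsum_congr fun mu => Set.indicator_apply _ _ _
  rw [← tsum_pow_size_of_part_eq_zero, h1]
  refine EqUpTo.tsum fun mu => ?_
  split_ifs with hmu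
  · exact EqUpTo.refl m _
  · have := (Ptn.lt_size_of_part_ne_zero hmu).le
    rw [← Nat.add_sub_cancel' this, pow_add]
    exact h.mul_zero_left _

theorem tsum_ennrealSchur_eqUpTo {t : MvPowerSeries σ ℝ≥0∞} {X Y : ℕ → MvPowerSeries σ ℝ≥0∞}
    {n : ℕ} (hX : ∀ i, n ≤ i → EqUpTo m (X i) 0) (hY : ∀ i, n ≤ i → EqUpTo m (Y i) 0)
    (ht : EqUpTo m (t ^ n) 0) :
    EqUpTo m
      (∑' p : Ptn × Ptn × Ptn,
        t ^ p.2.1.size * ennrealSchur X p.2.1 p.2.2 * ennrealSchur Y p.1 p.2.2)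
      (phiList (fun a => ∑' k : ℕ, a ^ k) ((List.range n).map Y)
        * ∏ k ∈ Finset.range n, (phiList (fun a => ∑' k : ℕ, a ^ k)
            (((List.range n).map Y ++ (List.range n).map X).map (t ^ (k + 1) * ·))
          * ∑' j : ℕ, (t ^ (k + 1)) ^ j)) := by
  have h1 : EqUpTo m
      (∑' lam : Ptn, ∑' mu : Ptn, ∑' gam : Ptn,
        t ^ mu.size * ennrealSchur X mu gam * ennrealSchur Y lam gam)
      (∑' lam : Ptn, ∑' mu : Ptn, ∑' gam : Ptn,
        t ^ mu.size * listSchur ((List.range n).map X) gam mu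
          * listSchur ((List.range n).map Y) gam lam) := by
    refine EqUpTo.tsum fun lam => ?_
    refine EqUpTo.tsum fun mu => ?_
    refine EqUpTo.tsum fun gam => ?_
    exact ((EqUpTo.refl m _).mul (ennrealSchur_eqUpTo_listSchur hX mu gam)).mul
      (ennrealSchur_eqUpTo_listSchur hY lam gam)
  have h2 : EqUpTo m
      (schurTotal t (((List.range n).map Y ++ (List.range n).map X).map (t ^ n * ·)))
      (∏ k ∈ Finset.range n, ∑' j : ℕ, (t ^ (k + 1)) ^ j) := by
    refine (schurTotal_eqUpTo t fun a ha => ?_).trans (tsum_pow_size_eqUpTo ht)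
    obtain ⟨b, -, rfl⟩ := List.mem_map.1 ha
    exact ht.mul_zero_left b
  simp only [tsum_prod_ennreal]
  refine h1.trans ?_
  rw [tsum_listSchur_mul_listSchur, schurTotal_eq_prod_mul _ _ n, Finset.prod_mul_distrib]
  exact (EqUpTo.refl m _).mul ((EqUpTo.refl m _).mul h2)

end

theorem phiList_perm {R : Type*} [CommMonoid R] (g : R → R) {l l' : List R} (h : l.Perm l') :
    phiList g l = phiList g l' := by
  induction h with
  | nil => rfl
  | cons a h ih =>
    simp only [phiList, ih, (h.map _).prod_eq]
  | swap a b l =>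
    simp only [phiList, List.map_cons, List.prod_cons, mul_comm b a]
    ac_rfl
  | trans _ _ ih₁ ih₂ => exact ih₁.trans ih₂

theorem map_phiList {R S : Type*} [CommSemiring R] [CommSemiring S] (φ : R →+* S) {g : R → R}
    {g' : S → S} (h : ∀ a, φ (g a) = g' (φ a)) (l : List R) :
    φ (phiList g l) = phiList g' (l.map φ) := by
  induction l with
  | nil => exact map_one φ
  | cons a l ih =>
    simp only [phiList, map_mul, h, ih, List.map_cons, map_list_prod, List.map_map,
      Function.comp_def]

theorem phiList_map_range {R : Type*} [CommMonoid R] (g : R → R) (a : ℕ → R) (n : ℕ) :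
    phiList g ((List.range n).map a) = (∏ i ∈ Finset.range n, g (a i))
      * ∏ j ∈ Finset.range n, ∏ i ∈ Finset.range j, g (a i * a j) := by
  induction n with
  | zero => simp [phiList]
  | succ n ih =>
    have h : (((List.range n).map a).map fun b => g (a n * b)).prod
        = ∏ i ∈ Finset.range n, g (a i * a n) := by
      simp only [mul_comm (a n), List.map_map]
      rfl
    calc phiList g ((List.range (n + 1)).map a) = phiList g (a n :: (List.range n).map a) := by
          rw [List.range_succ, List.map_append]
          exact phiList_perm g List.perm_append_comm
      _ = _ := by
          rw [phiList, ih, h, Finset.prod_range_succ, Finset.prod_range_succ]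
          ac_rfl

theorem phiList_tsum_pow_eq {σ : Type*} {l : List (MvPowerSeries σ ℝ≥0∞)}
    (h : ∀ a ∈ l, constantCoeff a = 0) :
    phiList (fun a => ∑' k : ℕ, a ^ k) l = phiList geo l := by
  induction l with
  | nil => rfl
  | cons a l ih =>
    have ha := h a List.mem_cons_self
    simp only [phiList]
    rw [ih fun b hb => h b (List.mem_cons_of_mem a hb), tsum_pow_eq_geo ha]
    congr 3
    exact List.map_congr_left fun b _ => tsum_pow_eq_geo (by rw [map_mul, ha, zero_mul])

namespace MvPowerSeries

variable {σ ι : Type*}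

theorem EqUpTo.mono {k : Type*} [CommSemiring k] {m m' : σ →₀ ℕ} {f g : MvPowerSeries σ k}
    (h : EqUpTo m f g) (hm : m' ≤ m) : EqUpTo m' f g :=
  fun d hd => h d (hd.trans hm)

instance : T2Space (MvPowerSeries σ ℚ) :=
  inferInstanceAs (T2Space ((σ →₀ ℕ) → ℚ))

theorem EqUpTo.prod_of_subset {k : Type*} [CommSemiring k] {m : σ →₀ ℕ}
    {f : ι → MvPowerSeries σ k} {s t : Finset ι} (hst : s ⊆ t)
    (hs : ∀ i, i ∉ s → EqUpTo m (f i) 1) : EqUpTo m (∏ i ∈ t, f i) (∏ i ∈ s, f i) := by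
  classical
  rw [← Finset.prod_sdiff hst]
  have h : EqUpTo m (∏ i ∈ t \ s, f i) (∏ i ∈ t \ s, 1) :=
    EqUpTo.prod _ fun i hi => hs i (Finset.mem_sdiff.1 hi).2
  simpa using h.mul (EqUpTo.refl m (∏ i ∈ s, f i))

theorem tprod_eqUpTo {f : ι → MvPowerSeries σ ℚ}
    (h : ∀ m, ∃ s : Finset ι, ∀ i, i ∉ s → EqUpTo m (f i) 1) {m : σ →₀ ℕ} {s : Finset ι}
    (hs : ∀ i, i ∉ s → EqUpTo m (f i) 1) : EqUpTo m (∏' i, f i) (∏ i ∈ s, f i) := by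
  classical
  choose S hS using h
  have hprod : HasProd f (fun d => coeff d (∏ i ∈ S d, f i) : MvPowerSeries σ ℚ) := by
    refine (tendsto_pi_nhds (A := fun _ : σ →₀ ℕ => ℚ)).2 fun d => ?_
    refine tendsto_const_nhds.congr' ?_
    rw [SummationFilter.unconditional_filter]
    filter_upwards [Filter.eventually_ge_atTop (S d)] with t ht
    exact (EqUpTo.prod_of_subset ht (hS d)).coeff_eq.symm
  intro d hd
  rw [hprod.tprod_eq]
  have hs' : ∀ i, i ∉ s → EqUpTo d (f i) 1 := fun i hi => (hs i hi).mono hd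
  exact ((EqUpTo.prod_of_subset (Finset.subset_union_left (s₂ := s)) (hS d)).symm.trans
    (EqUpTo.prod_of_subset Finset.subset_union_right hs')).coeff_eq

theorem Phi_eqUpTo {a : ℕ → MvPowerSeries σ ℚ} (ha : ∀ i, constantCoeff (a i) = 0)
    (h : ∀ m, ∃ n, ∀ i, n ≤ i → EqUpTo m (a i) 0) {m : σ →₀ ℕ} {n : ℕ}
    (hn : ∀ i, n ≤ i → EqUpTo m (a i) 0) :
    EqUpTo m (Phi a) (phiList geo ((List.range n).map a)) := by
  classical
  have h1 : ∀ {m : σ →₀ ℕ} {n : ℕ}, (∀ i, n ≤ i → EqUpTo m (a i) 0) →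
      ∀ i, i ∉ Finset.range n → EqUpTo m (geo (a i)) 1 := fun hn i hi =>
    (hn i (not_lt.1 (Finset.mem_range.not.1 hi))).geo
  have h2 : ∀ {m : σ →₀ ℕ} {n : ℕ}, (∀ i, n ≤ i → EqUpTo m (a i) 0) →
      ∀ p : {q : ℕ × ℕ // q.1 < q.2},
        p ∉ (Finset.range n ×ˢ Finset.range n).subtype (fun q : ℕ × ℕ => q.1 < q.2) →
        EqUpTo m (geo (a p.1.1 * a p.1.2)) 1 := fun {m n} hn p hp => by
    have hp2 : n ≤ p.1.2 := by
      have := p.2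
      simp only [Finset.mem_subtype, Finset.mem_product, Finset.mem_range] at hp
      omega
    exact ((hn _ hp2).mul_zero_right _).geo
  have h3 : ∏ p ∈ (Finset.range n ×ˢ Finset.range n).subtype (fun q : ℕ × ℕ => q.1 < q.2),
        geo (a p.1.1 * a p.1.2)
      = ∏ j ∈ Finset.range n, ∏ i ∈ Finset.range j, geo (a i * a j) := by
    rw [Finset.prod_sigma']
    refine Finset.prod_bij (fun p _ => ⟨p.1.2, p.1.1⟩) (fun p hp => ?_) (fun p _ q _ hpq => ?_)
      (fun p hp => ?_) fun p _ => rfl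
    · have := p.2
      simp only [Finset.mem_subtype, Finset.mem_product, Finset.mem_range] at hp
      simpa using ⟨hp.2, this⟩
    · simp only [Sigma.mk.injEq, heq_eq_eq] at hpq
      exact Subtype.ext (Prod.ext hpq.2 hpq.1)
    · simp only [Finset.mem_sigma, Finset.mem_range] at hp
      refine ⟨⟨(p.2, p.1), hp.2⟩, ?_, rfl⟩
      simp only [Finset.mem_subtype, Finset.mem_product, Finset.mem_range]
      omega
  have ha' : ∀ i j, constantCoeff (a i * a j) = 0 := fun i j => by rw [map_mul, ha, zero_mul]
  simp only [Phi, inv_one_sub_eq_geo (ha _), inv_one_sub_eq_geo (ha' _ _)]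
  rw [phiList_map_range, ← h3]
  refine (tprod_eqUpTo (fun m => ?_) (h1 hn)).mul (tprod_eqUpTo (fun m => ?_) (h2 hn))
  · obtain ⟨N, hN⟩ := h m
    exact ⟨_, h1 hN⟩
  · obtain ⟨N, hN⟩ := h m
    exact ⟨_, h2 hN⟩

theorem coeff_map_castRingHom (f : MvPowerSeries σ ℕ) (m : σ →₀ ℕ) (k : Type*) [CommSemiring k] :
    coeff m (map (Nat.castRingHom k) f) = ((coeff m f : ℕ) : k) := coeff_map _ _ _

theorem map_castRingHom_injective :
    Function.Injective (map (σ := σ) (Nat.castRingHom ℝ≥0∞)) := fun f g h => by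
  ext m
  have := congrArg (coeff m) h
  rw [coeff_map_castRingHom, coeff_map_castRingHom] at this
  exact Nat.cast_injective this

theorem exists_tsum_map_castRingHom_eq {g : ι → MvPowerSeries σ ℕ}
    (h : ∀ m, coeff m (∑' i, map (Nat.castRingHom ℝ≥0∞) (g i)) ≠ ⊤) :
    ∃ G : MvPowerSeries σ ℕ,
      ∑' i, map (Nat.castRingHom ℝ≥0∞) (g i) = map (Nat.castRingHom ℝ≥0∞) G ∧
      ∑' i, map (Nat.castRingHom ℚ) (g i) = map (Nat.castRingHom ℚ) G := by
  have hfin : ∀ m, {i | coeff m (g i) ≠ 0}.Finite := by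
    intro m
    have hm := h m
    simp only [coeff_tsum_ennreal, coeff_map_castRingHom] at hm
    refine (ENNReal.finite_const_le_of_tsum_ne_top hm one_ne_zero).subset fun i hi => ?_
    exact (Nat.one_le_cast (α := ℝ≥0∞)).2 (Nat.one_le_iff_ne_zero.2 hi)
  have hzero : ∀ m, ∀ i ∉ (hfin m).toFinset, coeff m (g i) = 0 := fun m i hi => by
    simpa using hi
  refine ⟨fun m => ∑ i ∈ (hfin m).toFinset, coeff m (g i), ?_, ?_⟩
  · ext m
    simp only [coeff_tsum_ennreal, coeff_map_castRingHom]
    rw [tsum_eq_sum fun i hi => by rw [hzero m i hi, Nat.cast_zero]]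
    exact (Nat.cast_sum _ _).symm
  · refine HasSum.tsum_eq ((Pi.hasSum (α := σ →₀ ℕ) (X := fun _ => ℚ)).2 fun m => ?_)
    have := hasSum_sum_of_ne_finset_zero (L := .unconditional ι)
      (f := fun i => ((coeff m (g i) : ℕ) : ℚ)) (s := (hfin m).toFinset)
      fun i hi => by rw [hzero m i hi, Nat.cast_zero]
    rw [← Nat.cast_sum] at this
    exact this

theorem coeff_ne_top_of_mul {f g : MvPowerSeries σ ℝ≥0∞} {p q : σ →₀ ℕ}
    (h : coeff (p + q) (f * g) ≠ ⊤) (hg : coeff q g ≠ 0) : coeff p f ≠ ⊤ := by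
  classical
  intro hf
  refine h (top_unique ?_)
  rw [coeff_mul, ← ENNReal.top_mul hg, ← hf]
  exact Finset.single_le_sum (f := fun x : (σ →₀ ℕ) × (σ →₀ ℕ) => coeff x.1 f * coeff x.2 g)
    (fun _ _ => zero_le) (Finset.HasAntidiagonal.mem_antidiagonal.2 rfl : (p, q) ∈ _)

theorem coeff_zero_ennrealSchur_self_ne_zero (X : ℕ → MvPowerSeries σ ℝ≥0∞) (mu : Ptn) :
    coeff 0 (ennrealSchur X mu mu) ≠ 0 := by
  have h := ENNReal.le_tsum (f := fun c : {c : ℕ → Ptn // IsSchurChain mu mu c} =>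
    coeff 0 (chainMonomial X c.1)) ⟨_, isSchurChain_const mu⟩
  rw [chainMonomial_const, coeff_zero_one, ← coeff_tsum_ennreal] at h
  exact (lt_of_lt_of_le zero_lt_one h).ne'

theorem exists_ennrealSchur_eq_map {X : ℕ → MvPowerSeries σ ℕ} {lam mu : Ptn}
    (h : ∀ m, coeff m
      (ennrealSchur (fun i => map (Nat.castRingHom ℝ≥0∞) (X i)) lam mu) ≠ ⊤) :
    ∃ G : MvPowerSeries σ ℕ,
      ennrealSchur (fun i => map (Nat.castRingHom ℝ≥0∞) (X i)) lam mu
        = map (Nat.castRingHom ℝ≥0∞) G ∧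
      skewSchur (fun i => map (Nat.castRingHom ℚ) (X i)) lam mu = map (Nat.castRingHom ℚ) G := by
  have hA := fun c : {c : ℕ → Ptn // IsSchurChain mu lam c} =>
    map_chainMonomial (map (Nat.castRingHom ℝ≥0∞)) X c.2
  have hQ := fun c : {c : ℕ → Ptn // IsSchurChain mu lam c} =>
    map_chainMonomial (map (Nat.castRingHom ℚ)) X c.2
  simp only [ennrealSchur, ← hA] at h ⊢
  obtain ⟨G, h1, h2⟩ := exists_tsum_map_castRingHom_eq h
  exact ⟨G, h1, (tsum_congr fun c => (hQ c).symm).trans h2⟩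

variable {σ k l : Type*} [CommSemiring k] [CommSemiring l]

/-- All variables of index at least `n`, and `tⁿ`, vanish up to `m`. -/
def TailVanishes (m : σ →₀ ℕ) (t : MvPowerSeries σ k) (X Y : ℕ → MvPowerSeries σ k) (n : ℕ) :
    Prop :=
  (∀ i, n ≤ i → EqUpTo m (X i) 0) ∧ (∀ i, n ≤ i → EqUpTo m (Y i) 0) ∧ EqUpTo m (t ^ n) 0

theorem TailVanishes.map (φ : k →+* l) {m : σ →₀ ℕ} {t : MvPowerSeries σ k}
    {X Y : ℕ → MvPowerSeries σ k} {n : ℕ} (h : TailVanishes m t X Y n) :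
    TailVanishes m (map φ t) (fun i => map φ (X i)) (fun i => map φ (Y i)) n := by
  refine ⟨fun i hi => ?_, fun i hi => ?_, ?_⟩
  · simpa using (h.1 i hi).map φ
  · simpa using (h.2.1 i hi).map φ
  · simpa using h.2.2.map φ

/-- The product `Φ(Y) ∏ⱼ Φ(tʲ(X + Y)) / (1 - tʲ)` truncated to the first `n` factors and
variables. -/
noncomputable def pairSeries (t : MvPowerSeries σ k) (X Y : ℕ → MvPowerSeries σ k) (n : ℕ) :
    MvPowerSeries σ k :=
  phiList geo ((List.range n).map Y)
    * ∏ j ∈ Finset.range n, (phiList geo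
        (((List.range n).map Y ++ (List.range n).map X).map (t ^ (j + 1) * ·))
      * geo (t ^ (j + 1)))

theorem map_pairSeries (φ : k →+* l) (t : MvPowerSeries σ k) (X Y : ℕ → MvPowerSeries σ k)
    (n : ℕ) : map φ (pairSeries t X Y n)
      = pairSeries (map φ t) (fun i => map φ (X i)) (fun i => map φ (Y i)) n := by
  simp only [pairSeries, map_mul, map_prod, map_phiList _ (map_geo φ), map_geo, map_pow,
    List.map_append, List.map_map, Function.comp_def]

theorem tsum_ennrealSchur_eqUpTo_pairSeries {m : σ →₀ ℕ} {t : MvPowerSeries σ ℝ≥0∞}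
    {X Y : ℕ → MvPowerSeries σ ℝ≥0∞} {n : ℕ} (ht : constantCoeff t = 0)
    (hY : ∀ i, constantCoeff (Y i) = 0) (h : TailVanishes m t X Y n) :
    EqUpTo m
      (∑' p : Ptn × Ptn × Ptn,
        t ^ p.2.1.size * ennrealSchur X p.2.1 p.2.2 * ennrealSchur Y p.1 p.2.2)
      (pairSeries t X Y n) := by
  have ht' : ∀ j, constantCoeff (t ^ (j + 1)) = 0 := fun j => by
    rw [map_pow, ht, zero_pow j.succ_ne_zero]
  refine (tsum_ennrealSchur_eqUpTo h.1 h.2.1 h.2.2).trans ?_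
  rw [phiList_tsum_pow_eq fun a ha => ?_, pairSeries]
  · refine (EqUpTo.refl m _).mul (EqUpTo.prod _ fun j _ => ?_)
    rw [tsum_pow_eq_geo (ht' j), phiList_tsum_pow_eq fun a ha => ?_]
    · exact EqUpTo.refl m _
    · obtain ⟨b, -, rfl⟩ := List.mem_map.1 ha
      rw [map_mul, ht', zero_mul]
  · obtain ⟨i, -, rfl⟩ := List.mem_map.1 ha
    exact hY i

theorem perm_map_range_alternate {R : Type*} (X Y : ℕ → R) (n : ℕ) :
    ((List.range (2 * n)).map fun i => if i % 2 = 0 then X (i / 2) else Y (i / 2)).Perm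
      ((List.range n).map Y ++ (List.range n).map X) := by
  induction n with
  | zero => exact List.Perm.refl _
  | succ n ih =>
    have h : 2 * (n + 1) = 2 * n + 1 + 1 := by ring
    have h1 : 2 * n % 2 = 0 := by omega
    have h2 : (2 * n + 1) % 2 ≠ 0 := by omega
    have h3 : 2 * n / 2 = n := by omega
    have h4 : (2 * n + 1) / 2 = n := by omega
    rw [h, List.range_succ, List.range_succ, List.range_succ]
    simp only [List.map_append, List.map_cons, List.map_nil, if_pos h1, if_neg h2, h3, h4]
    rw [← Multiset.coe_eq_coe] at ih ⊢
    simp only [← Multiset.coe_add] at ih ⊢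
    rw [ih]
    abel

theorem Phi_mul_tprod_eqUpTo_pairSeries {t : MvPowerSeries σ ℚ} {X Y u : ℕ → MvPowerSeries σ ℚ}
    (hu : ∀ i, u i = if i % 2 = 0 then X (i / 2) else Y (i / 2))
    (ht : constantCoeff t = 0) (hY : ∀ i, constantCoeff (Y i) = 0)
    (h : ∀ m, ∃ n, TailVanishes m t X Y n) {m : σ →₀ ℕ} {n : ℕ} (hn : TailVanishes m t X Y n) :
    EqUpTo m (Phi Y * ∏' j : ℕ, Phi (fun i => t ^ (j + 1) * u i) * (1 - t ^ (j + 1))⁻¹)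
      (pairSeries t X Y n) := by
  have ht' : ∀ j, constantCoeff (t ^ (j + 1)) = 0 := fun j => by
    rw [map_pow, ht, zero_pow j.succ_ne_zero]
  have htu : ∀ i j, constantCoeff (t ^ (j + 1) * u i) = 0 := fun i j => by
    rw [map_mul, ht', zero_mul]
  have hu0 : ∀ {m n}, TailVanishes m t X Y n → ∀ i, 2 * n ≤ i → EqUpTo m (u i) 0 := by
    intro m n hn i hi
    rw [hu]
    split_ifs
    · exact hn.1 _ (by omega)
    · exact hn.2.1 _ (by omega)
  have hPhi : ∀ {m n} (j : ℕ), (∀ i, n ≤ i → EqUpTo m (t ^ (j + 1) * u i) 0) →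
      EqUpTo m (Phi fun i => t ^ (j + 1) * u i)
        (phiList geo ((List.range n).map fun i => t ^ (j + 1) * u i)) := by
    intro m n j hmn
    refine Phi_eqUpTo (fun i => htu i j) (fun d => ?_) hmn
    obtain ⟨N, hN⟩ := h d
    exact ⟨2 * N, fun i hi => (hu0 hN i hi).mul_zero_right _⟩
  have hone : ∀ {m n}, TailVanishes m t X Y n → ∀ j, j ∉ Finset.range n →
      EqUpTo m (Phi (fun i => t ^ (j + 1) * u i) * geo (t ^ (j + 1))) 1 := by
    intro m n hn j hj
    have hj' : n ≤ j + 1 := by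
      rw [Finset.mem_range] at hj
      omega
    have ht0 : EqUpTo m (t ^ (j + 1)) 0 := by
      rw [← Nat.add_sub_cancel' hj', pow_add]
      exact hn.2.2.mul_zero_left _
    simpa [phiList] using (hPhi (n := 0) j fun i _ => ht0.mul_zero_left _).mul ht0.geo
  simp only [inv_one_sub_eq_geo (ht' _)]
  refine (Phi_eqUpTo hY (fun d => ?_) hn.2.1).mul
    ((tprod_eqUpTo (fun d => ?_) (hone hn)).trans (EqUpTo.prod _ fun j _ => ?_))
  · obtain ⟨N, hN⟩ := h d
    exact ⟨N, hN.2.1⟩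
  · obtain ⟨N, hN⟩ := h d
    exact ⟨_, hone hN⟩
  · refine EqUpTo.mul ?_ (EqUpTo.refl m _)
    have hperm := (perm_map_range_alternate X Y n).map (t ^ (j + 1) * ·)
    rw [← phiList_perm geo hperm]
    have := hPhi (n := 2 * n) (m := m) j fun i hi => (hu0 hn i hi).mul_zero_right _
    simpa only [hu, List.map_map, Function.comp_def] using this

theorem X_eqUpTo_zero {m : σ →₀ ℕ} {v : σ} (h : m v = 0) :
    EqUpTo m (X v : MvPowerSeries σ k) 0 := by
  classical
  intro d hd
  rw [coeff_X, if_neg, coeff_zero]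
  rintro rfl
  have := hd v
  simp [h] at this

theorem X_pow_eqUpTo_zero {m : σ →₀ ℕ} {v : σ} {n : ℕ} (h : m v < n) :
    EqUpTo m (X v ^ n : MvPowerSeries σ k) 0 := by
  classical
  intro d hd
  rw [coeff_X_pow, if_neg, coeff_zero]
  rintro rfl
  have := hd v
  simp at this
  omega

theorem exists_tailVanishes (m : σ →₀ ℕ) (v : σ) {x y : ℕ → σ} (hx : Function.Injective x)
    (hy : Function.Injective y) :
    ∃ n, TailVanishes (k := k) m (X v) (fun i => X (x i)) (fun i => X (y i)) n := by
  have key : ∀ {f : ℕ → σ}, Function.Injective f → ∃ n, ∀ i, n ≤ i → m (f i) = 0 := by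
    intro f hf
    obtain ⟨B, hB⟩ := (m.hasFiniteSupport.preimage hf.injOn).bddAbove
    refine ⟨B + 1, fun i hi => ?_⟩
    by_contra h0
    have := hB (show i ∈ f ⁻¹' Function.support m from h0)
    omega
  obtain ⟨a, ha⟩ := key hx
  obtain ⟨b, hb⟩ := key hy
  exact ⟨a + b + m v + 1, fun i hi => X_eqUpTo_zero (ha i (by omega)),
    fun i hi => X_eqUpTo_zero (hb i (by omega)), X_pow_eqUpTo_zero (by omega)⟩

variable {σ : Type*}

theorem tsum_skewSchur_pair_eq_of_injective (v : σ) {x y : ℕ → σ} (hx : Function.Injective x)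
    (hy : Function.Injective y) {u : ℕ → MvPowerSeries σ ℚ}
    (hu : ∀ i, u i = if i % 2 = 0 then X (x (i / 2)) else X (y (i / 2))) :
    ∑' p : Ptn × Ptn × Ptn, (X v : MvPowerSeries σ ℚ) ^ p.2.1.size
        * skewSchur (fun i => X (x i)) p.2.1 p.2.2 * skewSchur (fun i => X (y i)) p.1 p.2.2
      = Phi (fun i => X (y i))
        * ∏' j : ℕ, Phi (fun i => X v ^ (j + 1) * u i) * (1 - X v ^ (j + 1))⁻¹ := by
  choose N hN using fun m => exists_tailVanishes (k := ℕ) m v hx hy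
  let G : MvPowerSeries σ ℕ := fun m =>
    coeff m (pairSeries (X v) (fun i => X (x i)) (fun i => X (y i)) (N m))
  have hmapX : ∀ {k : Type} [CommSemiring k] (w : σ),
      map (Nat.castRingHom k) (X w) = X w := fun w => map_X _ w
  have hN' : ∀ {k : Type} [CommSemiring k] (m : σ →₀ ℕ),
      TailVanishes (k := k) m (X v) (fun i => X (x i)) (fun i => X (y i)) (N m) := fun {k} _ m => by
    simpa only [hmapX] using (hN m).map (Nat.castRingHom k)
  have hG : ∀ {k : Type} [CommSemiring k] (m : σ →₀ ℕ), coeff m (map (Nat.castRingHom k) G)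
      = coeff m (pairSeries (X v) (fun i => X (x i)) (fun i => X (y i)) (N m)) := fun {k} _ m => by
    have := map_pairSeries (Nat.castRingHom k) (X v : MvPowerSeries σ ℕ) (fun i => X (x i))
      (fun i => X (y i)) (N m)
    simp only [hmapX] at this
    rw [← this, coeff_map, coeff_map]
    rfl
  have hleft : ∑' p : Ptn × Ptn × Ptn, (X v : MvPowerSeries σ ℝ≥0∞) ^ p.2.1.size
        * ennrealSchur (fun i => X (x i)) p.2.1 p.2.2 * ennrealSchur (fun i => X (y i)) p.1 p.2.2
      = map (Nat.castRingHom ℝ≥0∞) G := by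
    ext m
    rw [hG]
    exact (tsum_ennrealSchur_eqUpTo_pairSeries (constantCoeff_X v)
      (fun i => constantCoeff_X (y i)) (hN' m)).coeff_eq
  have hright : Phi (fun i => X (y i))
        * ∏' j : ℕ, Phi (fun i => X v ^ (j + 1) * u i) * (1 - X v ^ (j + 1))⁻¹
      = map (Nat.castRingHom ℚ) G := by
    ext m
    rw [hG]
    exact (Phi_mul_tprod_eqUpTo_pairSeries hu (constantCoeff_X v)
      (fun i => constantCoeff_X (y i)) (fun m => ⟨_, hN' m⟩) (hN' m)).coeff_eq
  have hterm : ∀ (p : Ptn × Ptn × Ptn) (m : σ →₀ ℕ),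
      coeff m ((X v : MvPowerSeries σ ℝ≥0∞) ^ p.2.1.size
        * ennrealSchur (fun i => X (x i)) p.2.1 p.2.2
        * ennrealSchur (fun i => X (y i)) p.1 p.2.2) ≠ ⊤ := fun p m => by
    have h := congrArg (coeff m) hleft
    rw [coeff_tsum_ennreal, coeff_map_castRingHom] at h
    exact ne_top_of_le_ne_top (h ▸ ENNReal.natCast_ne_top _) (ENNReal.le_tsum p)
  have hone : ∀ n : ℕ, coeff (Finsupp.single v n) ((X v : MvPowerSeries σ ℝ≥0∞) ^ n) ≠ 0 := by
    classical
    intro n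
    rw [coeff_X_pow, if_pos rfl]
    exact one_ne_zero
  have hxfin : ∀ (mu gam : Ptn) (m : σ →₀ ℕ),
      coeff m (ennrealSchur (fun i => (X (x i) : MvPowerSeries σ ℝ≥0∞)) mu gam) ≠ ⊤ := by
    intro mu gam m
    have h := coeff_ne_top_of_mul (hterm (gam, mu, gam) ((m + Finsupp.single v mu.size) + 0))
      (coeff_zero_ennrealSchur_self_ne_zero _ gam)
    rw [mul_comm] at h
    exact coeff_ne_top_of_mul h (hone mu.size)
  have hyfin : ∀ (lam gam : Ptn) (m : σ →₀ ℕ),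
      coeff m (ennrealSchur (fun i => (X (y i) : MvPowerSeries σ ℝ≥0∞)) lam gam) ≠ ⊤ := by
    intro lam gam m
    have h := hterm (lam, gam, gam) ((m + Finsupp.single v gam.size) + 0)
    rw [mul_right_comm] at h
    have h' := coeff_ne_top_of_mul h (coeff_zero_ennrealSchur_self_ne_zero _ gam)
    rw [mul_comm] at h'
    exact coeff_ne_top_of_mul h' (hone gam.size)
  have hschur : ∀ {f : ℕ → σ}, (∀ (lam mu : Ptn) (m : σ →₀ ℕ),
      coeff m (ennrealSchur (fun i => (X (f i) : MvPowerSeries σ ℝ≥0∞)) lam mu) ≠ ⊤) →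
      ∀ lam mu : Ptn, ∃ S : MvPowerSeries σ ℕ,
        ennrealSchur (fun i => X (f i)) lam mu = map (Nat.castRingHom ℝ≥0∞) S ∧
        skewSchur (fun i => X (f i)) lam mu = map (Nat.castRingHom ℚ) S := fun {f} hf lam mu => by
    have := exists_ennrealSchur_eq_map (X := fun i => X (f i)) (lam := lam) (mu := mu)
    simp only [hmapX] at this
    exact this (hf lam mu)
  choose S hSA hSQ using hschur hxfin
  choose T hTA hTQ using hschur hyfin
  have hmul : ∀ {k : Type} [CommSemiring k] (p : Ptn × Ptn × Ptn),
      (X v : MvPowerSeries σ k) ^ p.2.1.size * map (Nat.castRingHom k) (S p.2.1 p.2.2)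
        * map (Nat.castRingHom k) (T p.1 p.2.2)
      = map (Nat.castRingHom k) (X v ^ p.2.1.size * S p.2.1 p.2.2 * T p.1 p.2.2) := fun p => by
    rw [map_mul, map_mul, map_pow, hmapX]
  simp only [hSA, hTA, hmul] at hleft
  obtain ⟨G', hA, hQ⟩ := exists_tsum_map_castRingHom_eq
    (g := fun p : Ptn × Ptn × Ptn => X v ^ p.2.1.size * S p.2.1 p.2.2 * T p.1 p.2.2)
    fun m => by
      rw [hleft, coeff_map_castRingHom]
      exact ENNReal.natCast_ne_top _
  simp only [hSQ, hTQ, hmul]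
  rw [hright, hQ, map_castRingHom_injective (hA.symm.trans hleft)]

end MvPowerSeries

end

/-- **Lemma 2.4**:
`Σ_{λ,μ,γ} z^{|μ|} s_{μ/γ}(X) s_{λ/γ}(Y) = Φ(Y) · ∏_{k≥1} Φ(z^k(X+Y))/(1-z^k)`.
The sum ranges over all triples of partitions `(λ, μ, γ)`. -/
theorem sum_skewSchur_pair_eq :
    ∑' t : Ptn × Ptn × Ptn, z ^ t.2.1.size * skewSchur Xa t.2.1 t.2.2 * skewSchur Ya t.1 t.2.2
    = Phi Ya * ∏' k : ℕ, Phi (fun n => z ^ (k + 1) * unionXY n) * (1 - z ^ (k + 1))⁻¹ := by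
  exact MvPowerSeries.tsum_skewSchur_pair_eq_of_injective (Sum.inr ())
    (fun _ _ h => by simpa using h) (fun _ _ h => by simpa using h) fun _ => rfl
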